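/- Let A be any set-linearizable implementation of the set-concurrent stack with multiplicity. Then every execution of A containing no two concurrent Pop operations is linearizable with respect to the sequential stack. -/

import Mathlib

/-- Operations of a stack over items in ℕ. -/
inductive StackOp
  | push (x : ℕ)
  | pop
  deriving DecidableEq

/-- Possible outputs: `ok` (= true, for push), an item, or empty (ε). -/
inductive StackRes
  | ok
  | val (x : ℕ)
  | empty
  deriving DecidableEq

/-- A concurrent history (execution at the interface level): `m` operations, each
with its kind, its invocation time, and, if it is completed, its response time and
its output (`none` in both fields means the operation is pending). -/
structure ConcHistory (Op Res : Type) where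
  m : ℕ
  op : Fin m → Op
  inv : Fin m → ℕ
  ret : Fin m → Option ℕ
  out : Fin m → Option Res

/-- `op i` precedes `op j`: the response of `i` occurs before the invocation of `j`. -/
def ConcHistory.precedes {Op Res : Type} (h : ConcHistory Op Res) (i j : Fin h.m) : Prop :=
  ∃ t, h.ret i = some t ∧ t < h.inv j

/-- Two operations are concurrent if they are incomparable w.r.t. `precedes`. -/
def ConcHistory.concurrent {Op Res : Type} (h : ConcHistory Op Res) (i j : Fin h.m) : Prop :=
  ¬ h.precedes i j ∧ ¬ h.precedes j i

/-- Transition of the set-concurrent stack with multiplicity taken by a concurrency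
class `C` of operations (given by their indices in a history): either a single push,
or between 1 and `n` concurrent pops all returning the top item, or a single pop
returning empty on the empty stack. -/
def stackClassDelta (n : ℕ) {m : ℕ} (op : Fin m → StackOp) (out : Fin m → StackRes)
    (q : List ℕ) (C : Finset (Fin m)) (q' : List ℕ) : Prop :=
  (∃ i x, C = {i} ∧ op i = StackOp.push x ∧ out i = StackRes.ok ∧ q' = x :: q) ∨
  (∃ x, q = x :: q' ∧ 1 ≤ C.card ∧ C.card ≤ n ∧
      ∀ i ∈ C, op i = StackOp.pop ∧ out i = StackRes.val x) ∨
  (∃ i, C = {i} ∧ op i = StackOp.pop ∧ out i = StackRes.empty ∧ q = [] ∧ q' = [])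

/-- A set-linearization of a history `h` w.r.t. the set-concurrent stack with
multiplicity (`n` processes): operations are assigned to `K` linearly ordered
concurrency classes (every completed operation is assigned, pending ones may be),
outputs agree with those of `h` on completed operations, consecutive classes are
related by the transition relation starting from the empty stack, and the
real-time order of `h` is respected. -/
structure SetLinearization (n : ℕ) (h : ConcHistory StackOp StackRes) where
  K : ℕ
  cls : Fin h.m → Option (Fin K)
  lout : Fin h.m → StackRes
  states : Fin (K + 1) → List ℕ
  complete_assigned : ∀ i, (h.out i).isSome → (cls i).isSome
  out_agree : ∀ i r, h.out i = some r → lout i = r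
  init : states 0 = []
  classes_nonempty : ∀ k : Fin K, ∃ i, cls i = some k
  step : ∀ k : Fin K,
    stackClassDelta n h.op lout (states k.castSucc)
      (Finset.univ.filter (fun i => cls i = some k)) (states k.succ)
  order : ∀ i j ki kj, h.precedes i j → cls i = some ki → cls j = some kj →
    (ki : ℕ) < (kj : ℕ)

/-- A history is set-linearizable w.r.t. the set-concurrent stack with multiplicity. -/
def SetLinearizable (n : ℕ) (h : ConcHistory StackOp StackRes) : Prop :=
  Nonempty (SetLinearization n h)

/-- Transition of the sequential stack. -/
def SeqStackDelta (q : List ℕ) (p : StackOp × StackRes) (q' : List ℕ) : Prop :=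
  (∃ x, p = (StackOp.push x, StackRes.ok) ∧ q' = x :: q) ∨
  (∃ x, q = x :: q' ∧ p = (StackOp.pop, StackRes.val x)) ∨
  (q = [] ∧ q' = [] ∧ p = (StackOp.pop, StackRes.empty))

/-- A sequential execution of the sequential stack. -/
inductive SeqStackExec : List ℕ → List (StackOp × StackRes) → List ℕ → Prop
  | nil (q : List ℕ) : SeqStackExec q [] q
  | cons {q q' q'' : List ℕ} {p : StackOp × StackRes} {ps : List (StackOp × StackRes)} :
      SeqStackDelta q p q' → SeqStackExec q' ps q'' → SeqStackExec q (p :: ps) q''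

/-- A linearization of a history `h` w.r.t. the sequential stack: a sequence of
(distinct) operations of `h` containing all completed ones, whose outputs agree
with `h`, respecting the real-time order of `h`, and forming a sequential execution
of the stack from the empty initial state. -/
structure Linearization (h : ConcHistory StackOp StackRes) where
  seq : List (Fin h.m)
  lout : Fin h.m → StackRes
  nodup : seq.Nodup
  complete_mem : ∀ i, (h.out i).isSome → i ∈ seq
  out_agree : ∀ i r, h.out i = some r → lout i = r
  order : ∀ k1 k2 : Fin seq.length,
    h.precedes (seq.get k1) (seq.get k2) → (k1 : ℕ) < (k2 : ℕ)
  valid : ∃ qf, SeqStackExec [] (seq.map (fun i => (h.op i, lout i))) qf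

/-- A history is linearizable w.r.t. the sequential stack. -/
def Linearizable (h : ConcHistory StackOp StackRes) : Prop :=
  Nonempty (Linearization h)

theorem SeqStackExec.ofFn {K : ℕ} (states : Fin (K + 1) → List ℕ) (p : Fin K → StackOp × StackRes)
    (hstep : ∀ k, SeqStackDelta (states k.castSucc) (p k) (states k.succ)) :
    SeqStackExec (states 0) (List.ofFn p) (states (Fin.last K)) := by
  induction K with
  | zero => simpa using SeqStackExec.nil (states 0)
  | succ K ih =>
    rw [List.ofFn_succ]
    exact .cons (hstep 0) (ih (fun k => states k.succ) (fun k => p k.succ) fun k => hstep k.succ)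

theorem stackClassDelta.seqStackDelta {n m : ℕ} {op : Fin m → StackOp} {out : Fin m → StackRes}
    {q q' : List ℕ} {i : Fin m} (hd : stackClassDelta n op out q {i} q') :
    SeqStackDelta q (op i, out i) q' := by
  rcases hd with ⟨j, x, hj, hop, hout, hq⟩ | ⟨x, hq, -, -, hall⟩ | ⟨j, hj, hop, hout, hq, hq'⟩
  · obtain rfl := Finset.singleton_injective hj
    exact .inl ⟨x, by rw [hop, hout], hq⟩
  · obtain ⟨hop, hout⟩ := hall i (Finset.mem_singleton_self i)
    exact .inr (.inl ⟨x, hq, by rw [hop, hout]⟩)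
  · obtain rfl := Finset.singleton_injective hj
    exact .inr (.inr ⟨hq, hq', by rw [hop, hout]⟩)

/-- A class with two distinct members consists of pops. -/
theorem stackClassDelta.eq_pop_of_ne {n m : ℕ} {op : Fin m → StackOp} {out : Fin m → StackRes}
    {q q' : List ℕ} {C : Finset (Fin m)} (hd : stackClassDelta n op out q C q') {i j : Fin m}
    (hi : i ∈ C) (hj : j ∈ C) (hij : i ≠ j) : op i = StackOp.pop ∧ op j = StackOp.pop := by
  rcases hd with ⟨l, x, rfl, -⟩ | ⟨x, -, -, -, hall⟩ | ⟨l, rfl, -⟩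
  · rw [Finset.mem_singleton] at hi hj
    exact absurd (hi.trans hj.symm) hij
  · exact ⟨(hall i hi).1, (hall j hj).1⟩
  · rw [Finset.mem_singleton] at hi hj
    exact absurd (hi.trans hj.symm) hij

/-- Without concurrent pops, every class of a set-linearization has a single member. -/
theorem SetLinearization.eq_of_cls_eq {n : ℕ} {h : ConcHistory StackOp StackRes}
    (L : SetLinearization n h)
    (hpops : ∀ i j : Fin h.m, i ≠ j → h.op i = StackOp.pop → h.op j = StackOp.pop →
      ¬ h.concurrent i j)
    {i j : Fin h.m} {k : Fin L.K} (hi : L.cls i = some k) (hj : L.cls j = some k) : i = j := by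
  by_contra hij
  obtain ⟨hpi, hpj⟩ := (L.step k).eq_pop_of_ne (by simpa using hi) (by simpa using hj) hij
  exact hpops i j hij hpi hpj
    ⟨fun hp => (L.order i j k k hp hi hj).false, fun hp => (L.order j i k k hp hj hi).false⟩

/-- Let `A` be any set-linearizable implementation (identified with its set of
histories) of the set-concurrent stack with multiplicity.  Then every execution of
`A` containing no two concurrent Pop operations is linearizable with respect to the
sequential stack. -/
theorem setLinearizableStack_noConcurrentPops_linearizable
    (n : ℕ) (A : Set (ConcHistory StackOp StackRes))
    (hA : ∀ h ∈ A, SetLinearizable n h)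
    (h : ConcHistory StackOp StackRes) (hmem : h ∈ A)
    (hpops : ∀ i j : Fin h.m, i ≠ j → h.op i = StackOp.pop → h.op j = StackOp.pop →
      ¬ h.concurrent i j) :
    Linearizable h := by
  obtain ⟨L⟩ := hA h hmem
  choose f hf using L.classes_nonempty
  have hinj : Function.Injective f := fun a b hab =>
    Option.some_injective _ ((hf a).symm.trans (hab ▸ hf b))
  have hcls : ∀ k, (Finset.univ.filter fun i => L.cls i = some k) = {f k} := by
    intro k
    ext i
    simp only [Finset.mem_filter, Finset.mem_univ, true_and, Finset.mem_singleton]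
    exact ⟨fun hi => L.eq_of_cls_eq hpops hi (hf k), fun hi => hi ▸ hf k⟩
  refine ⟨⟨List.ofFn f, L.lout, List.nodup_ofFn.2 hinj, fun i hi => ?_, L.out_agree,
    fun k₁ k₂ hp => ?_, L.states (Fin.last L.K), ?_⟩⟩
  · obtain ⟨k, hk⟩ := Option.isSome_iff_exists.1 (L.complete_assigned i hi)
    exact List.mem_ofFn.2 ⟨k, L.eq_of_cls_eq hpops (hf k) hk⟩
  · rw [List.get_ofFn, List.get_ofFn] at hp
    simpa using L.order _ _ _ _ hp (hf _) (hf _)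
  · rw [List.map_ofFn, ← L.init]
    exact SeqStackExec.ofFn _ _ fun k => (hcls k ▸ L.step k).seqStackDelta
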